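/- The quotient of the free group on four generators α, β, γ, δ by the normal closure of the three elements α²γ, δγ⁻¹β⁻¹γ, and αβδ⁻² is isomorphic to the group G₁ = ⟨A, B ∣ A⁻¹B⁻¹A²B²⟩. -/

import Mathlib

/-- The relator `A⁻¹ B⁻¹ A² B²` in the free group on two generators `A = of 0`, `B = of 1`. -/
abbrev rel₁ : Set (FreeGroup (Fin 2)) :=
  {(FreeGroup.of 0)⁻¹ * (FreeGroup.of 1)⁻¹ * FreeGroup.of 0 ^ 2 * FreeGroup.of 1 ^ 2}

/-- `G₁ = ⟨A, B ∣ A⁻¹B⁻¹A²B²⟩` -/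
abbrev G₁ : Type := PresentedGroup rel₁

/-- The relators `α²γ`, `δγ⁻¹β⁻¹γ`, `αβδ⁻²` in the free group on four generators
`α = of 0`, `β = of 1`, `γ = of 2`, `δ = of 3`. -/
abbrev rels₀₁ : Set (FreeGroup (Fin 4)) :=
  {FreeGroup.of 0 ^ 2 * FreeGroup.of 2,
   FreeGroup.of 3 * (FreeGroup.of 2)⁻¹ * (FreeGroup.of 1)⁻¹ * FreeGroup.of 2,
   FreeGroup.of 0 * FreeGroup.of 1 * (FreeGroup.of 3 ^ 2)⁻¹}

namespace PresentedGroup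

theorem rel₁_relation :
    (of 0 : G₁)⁻¹ * (of 1)⁻¹ * of 0 ^ 2 * of 1 ^ 2 = 1 :=
  one_of_mem (rels := rel₁) (Set.mem_singleton _)

theorem rels₀₁_gamma :
    (of 2 : PresentedGroup rels₀₁) = (of 0 ^ 2)⁻¹ :=
  (inv_eq_of_mul_eq_one_right (one_of_mem (rels := rels₀₁) (Or.inl rfl))).symm

theorem rels₀₁_beta :
    (of 1 : PresentedGroup rels₀₁) = (of 0 ^ 2)⁻¹ * of 3 * of 0 ^ 2 := by
  have h : (of 3 : PresentedGroup rels₀₁) * (of 2)⁻¹ * (of 1)⁻¹ * of 2 = 1 :=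
    one_of_mem (rels := rels₀₁) (Or.inr (Or.inl rfl))
  rw [rels₀₁_gamma, mul_inv_eq_one, mul_inv_eq_iff_eq_mul, inv_inv] at h
  rw [mul_assoc, h, inv_mul_cancel_left]

theorem rels₀₁_relation :
    (of 0 : PresentedGroup rels₀₁)⁻¹ * of 3 * of 0 ^ 2 * (of 3 ^ 2)⁻¹ = 1 := by
  have h : (of 0 : PresentedGroup rels₀₁) * of 1 * (of 3 ^ 2)⁻¹ = 1 :=
    one_of_mem (rels := rels₀₁) (Or.inr (Or.inr rfl))
  rw [rels₀₁_beta] at h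
  rw [← h]
  group

end PresentedGroup

open PresentedGroup in
theorem stmt_8 : Nonempty (PresentedGroup rels₀₁ ≃* G₁) := by
  let f : Fin 4 → G₁ :=
    ![of 0, (of 0 ^ 2)⁻¹ * (of 1)⁻¹ * of 0 ^ 2, (of 0 ^ 2)⁻¹, (of 1)⁻¹]
  let g : Fin 2 → PresentedGroup rels₀₁ := ![of 0, (of 3)⁻¹]
  have hf : ∀ r ∈ rels₀₁, FreeGroup.lift f r = 1 := by
    rintro r (rfl | rfl | rfl)
    · simp [f]
    · simp [f, mul_assoc]
    · rw [← rel₁_relation]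
      simp only [map_mul, map_inv, map_pow, FreeGroup.lift_apply_of, f, Matrix.cons_val]
      group
  have hg : ∀ r ∈ rel₁, FreeGroup.lift g r = 1 := by
    rintro r rfl
    rw [← rels₀₁_relation]
    simp [g]
  refine ⟨MonoidHom.toMulEquiv (toGroup hf) (toGroup hg) ?_ ?_⟩
  · ext i
    fin_cases i
    · simp [f, g]
    · simp [f, g, rels₀₁_beta]
    · simp [f, g, rels₀₁_gamma]
    · simp [f, g]
  · ext i
    fin_cases i <;> simp [f, g]
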